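/- arXiv:2308.13216 — 2 statements merged into one kernel-verified Lean document; each statement's English description precedes it below -/
import Mathlib

section
/- The normalized 3-point Gauss quadrature G₃(f) = (5/18)·f(−√(3/5)) + (4/9)·f(0) + (5/18)·f(√(3/5)) and the normalized 4-point Lobatto quadrature L₄(f) = (1/12)·f(−1) + (5/12)·f(−1/√5) + (5/12)·f(1/√5) + (1/12)·f(1) are incomparable in the class of 3-convex functions on [-1,1]: there exists a continuous 3-convex function f : [-1,1] → ℝ with G₃(f) < L₄(f) and a continuous 3-convex function g : [-1,1] → ℝ with G₃(g) > L₄(g). -/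
open MeasureTheory Set

/-- Divided differences: `dividedDiff f k x` is `f[x 0, x 1, ..., x k]`,
defined by the recursion `f[x₁] = f(x₁)` and
`f[x₁,…,x_k] = (f[x₂,…,x_k] − f[x₁,…,x_{k−1}]) / (x_k − x₁)`. -/
noncomputable def dividedDiff (f : ℝ → ℝ) : (k : ℕ) → (Fin (k + 1) → ℝ) → ℝ
  | 0, x => f (x 0)
  | k + 1, x =>
      (dividedDiff f k (fun i => x i.succ) - dividedDiff f k (fun i => x i.castSucc)) /
        (x (Fin.last (k + 1)) - x 0)

/-- `f` is `n`-convex on `I` if every divided difference of `f` at `n + 2`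
pairwise distinct points of `I` is nonnegative. -/
def NConvexOn (n : ℕ) (I : Set ℝ) (f : ℝ → ℝ) : Prop :=
  ∀ x : Fin (n + 2) → ℝ, (∀ i, x i ∈ I) → Function.Injective x →
    0 ≤ dividedDiff f (n + 1) x

noncomputable def hA (m : ℕ) (a b : ℝ) : ℝ := ∑ i ∈ Finset.range (m + 1), a ^ i * b ^ (m - i)
noncomputable def hB (m : ℕ) (a b c : ℝ) : ℝ := ∑ i ∈ Finset.range (m + 1), hA i a b * c ^ (m - i)
noncomputable def hC (m : ℕ) (a b c d : ℝ) : ℝ :=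
  ∑ i ∈ Finset.range (m + 1), hB i a b c * d ^ (m - i)

lemma dd_formula (p q : ℝ) (x : Fin 5 → ℝ) (hx : Function.Injective x) :
    dividedDiff (fun t => p * t ^ 4 + q * t ^ 6) 4 x =
      p + q * (((x 0 + x 1 + x 2 + x 3 + x 4) ^ 2 +
        (x 0 ^ 2 + x 1 ^ 2 + x 2 ^ 2 + x 3 ^ 2 + x 4 ^ 2)) / 2) := by
  have ne : ∀ i j : Fin 5, i ≠ j → x i - x j ≠ 0 := fun i j h => sub_ne_zero.mpr (hx.ne h)
  have s1 : ∀ a b : ℝ, b - a ≠ 0 →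
      ((p * b ^ 4 + q * b ^ 6) - (p * a ^ 4 + q * a ^ 6)) / (b - a) =
        p * hA 3 a b + q * hA 5 a b := by
    intro a b h
    rw [div_eq_iff h]
    simp only [hA, Finset.sum_range_succ, Finset.sum_range_zero]
    norm_num
    ring
  have s2 : ∀ a b c : ℝ, c - a ≠ 0 →
      ((p * hA 3 b c + q * hA 5 b c) - (p * hA 3 a b + q * hA 5 a b)) / (c - a) =
        p * hB 2 a b c + q * hB 4 a b c := by
    intro a b c h
    rw [div_eq_iff h]
    simp only [hA, hB, Finset.sum_range_succ, Finset.sum_range_zero]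
    norm_num
    ring
  have s3 : ∀ a b c d : ℝ, d - a ≠ 0 →
      ((p * hB 2 b c d + q * hB 4 b c d) - (p * hB 2 a b c + q * hB 4 a b c)) / (d - a) =
        p * hC 1 a b c d + q * hC 3 a b c d := by
    intro a b c d h
    rw [div_eq_iff h]
    simp only [hA, hB, hC, Finset.sum_range_succ, Finset.sum_range_zero]
    norm_num
    ring
  have s4 : ∀ a b c d e : ℝ, e - a ≠ 0 →
      ((p * hC 1 b c d e + q * hC 3 b c d e) - (p * hC 1 a b c d + q * hC 3 a b c d)) / (e - a) =
        p + q * (((a + b + c + d + e) ^ 2 + (a ^ 2 + b ^ 2 + c ^ 2 + d ^ 2 + e ^ 2)) / 2) := by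
    intro a b c d e h
    rw [div_eq_iff h]
    simp only [hA, hB, hC, Finset.sum_range_succ, Finset.sum_range_zero]
    norm_num
    ring
  rw [← s4 _ _ _ _ _ (ne 4 0 (by decide)), ← s3 _ _ _ _ (ne 4 1 (by decide)),
    ← s3 _ _ _ _ (ne 3 0 (by decide)), ← s2 _ _ _ (ne 4 2 (by decide)),
    ← s2 _ _ _ (ne 3 1 (by decide)), ← s2 _ _ _ (ne 2 0 (by decide)),
    ← s1 _ _ (ne 4 3 (by decide)), ← s1 _ _ (ne 3 2 (by decide)),
    ← s1 _ _ (ne 2 1 (by decide)), ← s1 _ _ (ne 1 0 (by decide))]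
  rfl

theorem stmt18 :
    (∃ f : ℝ → ℝ, ContinuousOn f (Set.Icc (-1 : ℝ) 1) ∧
      NConvexOn 3 (Set.Icc (-1 : ℝ) 1) f ∧
      (5 / 18) * f (-Real.sqrt (3 / 5)) + (4 / 9) * f 0 + (5 / 18) * f (Real.sqrt (3 / 5)) <
        (1 / 12) * f (-1) + (5 / 12) * f (-(1 / Real.sqrt 5)) + (5 / 12) * f (1 / Real.sqrt 5) +
          (1 / 12) * f 1) ∧
    (∃ g : ℝ → ℝ, ContinuousOn g (Set.Icc (-1 : ℝ) 1) ∧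
      NConvexOn 3 (Set.Icc (-1 : ℝ) 1) g ∧
      (1 / 12) * g (-1) + (5 / 12) * g (-(1 / Real.sqrt 5)) + (5 / 12) * g (1 / Real.sqrt 5) +
          (1 / 12) * g 1 <
        (5 / 18) * g (-Real.sqrt (3 / 5)) + (4 / 9) * g 0 + (5 / 18) * g (Real.sqrt (3 / 5))) := by
  have a2 : Real.sqrt (3 / 5) ^ 2 = 3 / 5 := Real.sq_sqrt (by norm_num)
  have b2 : (1 / Real.sqrt 5) ^ 2 = 1 / 5 := by
    rw [div_pow, Real.sq_sqrt (by norm_num)]; norm_num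
  generalize Real.sqrt (3 / 5) = a at *
  generalize 1 / Real.sqrt 5 = b at *
  have a4 : a ^ 4 = 9 / 25 := by rw [show a ^ 4 = (a ^ 2) ^ 2 by ring, a2]; norm_num
  have a6 : a ^ 6 = 27 / 125 := by rw [show a ^ 6 = (a ^ 2) ^ 3 by ring, a2]; norm_num
  have b4 : b ^ 4 = 1 / 25 := by rw [show b ^ 4 = (b ^ 2) ^ 2 by ring, b2]; norm_num
  have b6 : b ^ 6 = 1 / 125 := by rw [show b ^ 6 = (b ^ 2) ^ 3 by ring, b2]; norm_num
  have e4 : ∀ t : ℝ, (-t) ^ 4 = t ^ 4 := fun t => by ring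
  have e6 : ∀ t : ℝ, (-t) ^ 6 = t ^ 6 := fun t => by ring
  refine ⟨⟨fun t => 0 * t ^ 4 + 1 * t ^ 6, by fun_prop, ?_, ?_⟩,
    ⟨fun t => 15 * t ^ 4 + (-1) * t ^ 6, by fun_prop, ?_, ?_⟩⟩
  · intro x _ hx
    rw [dd_formula 0 1 x hx]
    positivity
  · simp only [e4, e6, a4, a6, b4, b6]
    norm_num
  · intro x hI hx
    rw [dd_formula 15 (-1) x hx]
    have sq : ∀ i, x i ^ 2 ≤ 1 := fun i => by
      obtain ⟨h1, h2⟩ := hI i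
      nlinarith
    have hs : (x 0 + x 1 + x 2 + x 3 + x 4) ^ 2 ≤ 5 ^ 2 := by
      have l := fun i => (hI i).1
      have u := fun i => (hI i).2
      apply sq_le_sq'
      · linarith [l 0, l 1, l 2, l 3, l 4]
      · linarith [u 0, u 1, u 2, u 3, u 4]
    linarith [sq 0, sq 1, sq 2, sq 3, sq 4]
  · simp only [e4, e6, a4, a6, b4, b6]
    norm_num
end

section
/- The normalized 3-point Gauss quadrature G₃(f) = (5/18)·f(−√(3/5)) + (4/9)·f(0) + (5/18)·f(√(3/5)) and the normalized 5-point Lobatto quadrature L₅(f) = (1/20)·f(−1) + (49/180)·f(−√(3/7)) + (16/45)·f(0) + (49/180)·f(√(3/7)) + (1/20)·f(1) are incomparable in the class of 3-convex functions on [-1,1]: there exists a continuous 3-convex function f : [-1,1] → ℝ with G₃(f) < L₅(f) and a continuous 3-convex function g : [-1,1] → ℝ with G₃(g) > L₅(g). -/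
open MeasureTheory Set

noncomputable def qq1 (p q a b : ℝ) : ℝ := p * (a*a*a + a*a*b + a*b*b + b*b*b) + q * (a*a*a*a*a + a*a*a*a*b + a*a*a*b*b + a*a*b*b*b + a*b*b*b*b + b*b*b*b*b)

lemma dd1 (p q : ℝ) (x : Fin 2 → ℝ) (hx : Function.Injective x) :
    dividedDiff (fun t => p * t^4 + q * t^6) 1 x = qq1 p q (x 0) (x 1) := by
  have hne : x 1 - x 0 ≠ 0 := sub_ne_zero.2 (fun h => by simpa using hx h)
  rw [dividedDiff]
  simp only [dividedDiff]
  change ((p * x 1 ^ 4 + q * x 1 ^ 6) - (p * x 0 ^ 4 + q * x 0 ^ 6)) / (x 1 - x 0) = _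
  rw [div_eq_iff hne]
  simp only [qq1]
  ring

noncomputable def qq2 (p q a b c : ℝ) : ℝ := p * (a*a + a*b + a*c + b*b + b*c + c*c) + q * (a*a*a*a + a*a*a*b + a*a*a*c + a*a*b*b + a*a*b*c + a*a*c*c + a*b*b*b + a*b*b*c + a*b*c*c + a*c*c*c + b*b*b*b + b*b*b*c + b*b*c*c + b*c*c*c + c*c*c*c)

lemma dd2 (p q : ℝ) (x : Fin 3 → ℝ) (hx : Function.Injective x) :
    dividedDiff (fun t => p * t^4 + q * t^6) 2 x = qq2 p q (x 0) (x 1) (x 2) := by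
  have hne : x 2 - x 0 ≠ 0 := sub_ne_zero.2 (fun h => by simpa using hx h)
  rw [dividedDiff]
  rw [dd1 p q (fun i => x i.succ) (hx.comp (Fin.succ_injective _)), dd1 p q (fun i => x i.castSucc) (hx.comp (Fin.castSucc_injective _))]
  change (qq1 p q (x 1) (x 2) - qq1 p q (x 0) (x 1)) / (x 2 - x 0) = _
  rw [div_eq_iff hne]
  simp only [qq1, qq2]
  ring

noncomputable def qq3 (p q a b c d : ℝ) : ℝ := p * (a + b + c + d) + q * (a*a*a + a*a*b + a*a*c + a*a*d + a*b*b + a*b*c + a*b*d + a*c*c + a*c*d + a*d*d + b*b*b + b*b*c + b*b*d + b*c*c + b*c*d + b*d*d + c*c*c + c*c*d + c*d*d + d*d*d)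

lemma dd3 (p q : ℝ) (x : Fin 4 → ℝ) (hx : Function.Injective x) :
    dividedDiff (fun t => p * t^4 + q * t^6) 3 x = qq3 p q (x 0) (x 1) (x 2) (x 3) := by
  have hne : x 3 - x 0 ≠ 0 := sub_ne_zero.2 (fun h => by simpa using hx h)
  rw [dividedDiff]
  rw [dd2 p q (fun i => x i.succ) (hx.comp (Fin.succ_injective _)), dd2 p q (fun i => x i.castSucc) (hx.comp (Fin.castSucc_injective _))]
  change (qq2 p q (x 1) (x 2) (x 3) - qq2 p q (x 0) (x 1) (x 2)) / (x 3 - x 0) = _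
  rw [div_eq_iff hne]
  simp only [qq2, qq3]
  ring

noncomputable def qq4 (p q a b c d e : ℝ) : ℝ := p * (1) + q * (a*a + a*b + a*c + a*d + a*e + b*b + b*c + b*d + b*e + c*c + c*d + c*e + d*d + d*e + e*e)

lemma dd4 (p q : ℝ) (x : Fin 5 → ℝ) (hx : Function.Injective x) :
    dividedDiff (fun t => p * t^4 + q * t^6) 4 x = qq4 p q (x 0) (x 1) (x 2) (x 3) (x 4) := by
  have hne : x 4 - x 0 ≠ 0 := sub_ne_zero.2 (fun h => by simpa using hx h)
  rw [dividedDiff]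
  rw [dd3 p q (fun i => x i.succ) (hx.comp (Fin.succ_injective _)), dd3 p q (fun i => x i.castSucc) (hx.comp (Fin.castSucc_injective _))]
  change (qq3 p q (x 1) (x 2) (x 3) (x 4) - qq3 p q (x 0) (x 1) (x 2) (x 3)) / (x 4 - x 0) = _
  rw [div_eq_iff hne]
  simp only [qq3, qq4]
  ring

theorem stmt19 :
    (∃ f : ℝ → ℝ, ContinuousOn f (Set.Icc (-1 : ℝ) 1) ∧
      NConvexOn 3 (Set.Icc (-1 : ℝ) 1) f ∧
      (5 / 18) * f (-Real.sqrt (3 / 5)) + (4 / 9) * f 0 + (5 / 18) * f (Real.sqrt (3 / 5)) <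
        (1 / 20) * f (-1) + (49 / 180) * f (-Real.sqrt (3 / 7)) + (16 / 45) * f 0 +
          (49 / 180) * f (Real.sqrt (3 / 7)) + (1 / 20) * f 1) ∧
    (∃ g : ℝ → ℝ, ContinuousOn g (Set.Icc (-1 : ℝ) 1) ∧
      NConvexOn 3 (Set.Icc (-1 : ℝ) 1) g ∧
      (1 / 20) * g (-1) + (49 / 180) * g (-Real.sqrt (3 / 7)) + (16 / 45) * g 0 +
          (49 / 180) * g (Real.sqrt (3 / 7)) + (1 / 20) * g 1 <
        (5 / 18) * g (-Real.sqrt (3 / 5)) + (4 / 9) * g 0 + (5 / 18) * g (Real.sqrt (3 / 5))) := by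
  have h5 : Real.sqrt (3 / 5) ^ 2 = 3 / 5 := Real.sq_sqrt (by norm_num)
  have h7 : Real.sqrt (3 / 7) ^ 2 = 3 / 7 := Real.sq_sqrt (by norm_num)
  have e4 : ∀ t : ℝ, t ^ 4 = (t ^ 2) ^ 2 := fun t => by ring
  have e6 : ∀ t : ℝ, t ^ 6 = (t ^ 2) ^ 3 := fun t => by ring
  refine ⟨⟨fun t => 0 * t ^ 4 + 1 * t ^ 6, by fun_prop, ?_, ?_⟩,
    ⟨fun t => 15 * t ^ 4 + (-1) * t ^ 6, by fun_prop, ?_, ?_⟩⟩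
  · intro x hI hx
    rw [dd4 _ _ x hx, qq4]
    nlinarith [sq_nonneg (x 0 + x 1 + x 2 + x 3 + x 4), sq_nonneg (x 0), sq_nonneg (x 1),
      sq_nonneg (x 2), sq_nonneg (x 3), sq_nonneg (x 4)]
  · simp only [e4, e6, neg_sq, h5, h7]
    norm_num
  · intro x hI hx
    rw [dd4 _ _ x hx, qq4]
    have key : ∀ i j, x i * x j ≤ 1 := fun i j => by
      have h1 := hI i
      have h2 := hI j
      rw [mem_Icc] at h1 h2
      nlinarith [h1.1, h1.2, h2.1, h2.2, sq_nonneg (x i - x j)]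
    linarith [key 0 0, key 0 1, key 0 2, key 0 3, key 0 4, key 1 1, key 1 2, key 1 3, key 1 4, key 2 2, key 2 3, key 2 4, key 3 3, key 3 4, key 4 4]
  · simp only [e4, e6, neg_sq, h5, h7]
    norm_num
end
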